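/- Let μ ∈ M be strictly positive. Then the set of eccentricity exponents of μ, namely {γ > 0 : μ^γ is eccentric}, equals the interval [δ̲(μ), δ̄(μ)] ∩ (0,∞); in particular it is a relatively closed subinterval of (0,∞) with endpoints δ̲(μ) and δ̄(μ). -/

import Mathlib

open Filter MeasureTheory
open scoped Classical

/-- `(1/log l)·limsup_{x→∞} log(μ(x)/μ(l·x))`, as an element of `[0,∞]`. -/
noncomputable def ratioSup (μ : ℝ → ℝ) (l : ℝ) : ENNReal :=
  Filter.limsup (fun x : ℝ => ENNReal.ofReal (Real.log (μ x / μ (l * x)) / Real.log l))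
    Filter.atTop

/-- `(1/log l)·liminf_{x→∞} log(μ(x)/μ(l·x))`, as an element of `[0,∞]`. -/
noncomputable def ratioInf (μ : ℝ → ℝ) (l : ℝ) : ENNReal :=
  Filter.liminf (fun x : ℝ => ENNReal.ofReal (Real.log (μ x / μ (l * x)) / Real.log l))
    Filter.atTop

/-- `d = δ̲(μ)`, with the conventions `1/0 = +∞`, `1/(+∞) = 0` (those of `ℝ≥0∞`). -/
def IsDeltaLow (μ : ℝ → ℝ) (d : ENNReal) : Prop :=
  ∃ D : ENNReal, d = D⁻¹ ∧ Filter.Tendsto (ratioSup μ) Filter.atTop (nhds D)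

/-- `d = δ̄(μ)`, with the conventions `1/0 = +∞`, `1/(+∞) = 0` (those of `ℝ≥0∞`). -/
def IsDeltaUp (μ : ℝ → ℝ) (d : ENNReal) : Prop :=
  ∃ D : ENNReal, d = D⁻¹ ∧ Filter.Tendsto (ratioInf μ) Filter.atTop (nhds D)

/-- The integral function `S_μ`: `S_μ(x) = ∫_x^∞ μ` if `μ` is integrable on `(0,∞)`,
and `S_μ(x) = ∫_0^x μ` otherwise. -/
noncomputable def Sfun (μ : ℝ → ℝ) (x : ℝ) : ℝ :=
  if IntegrableOn μ (Set.Ioi (0:ℝ)) then ∫ t in Set.Ioi x, μ t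
  else ∫ t in Set.Ioc (0:ℝ) x, μ t

/-- `μ` is eccentric if for some `l > 1`, `1` is a limit point as `x → ∞`
of `x ↦ S_μ(l·x)/S_μ(x)`. -/
def Eccentric (μ : ℝ → ℝ) : Prop :=
  ∃ l : ℝ, 1 < l ∧ MapClusterPt (1:ℝ) Filter.atTop (fun x => Sfun μ (l * x) / Sfun μ x)

section AntitoneIntegrals

variable {ν : ℝ → ℝ}

lemma intervalIntegrable_of_antitoneOn_Ici (ha : AntitoneOn ν (Set.Ici 0)) {a b : ℝ}
    (h0 : 0 ≤ a) (h1 : 0 ≤ b) : IntervalIntegrable ν volume a b :=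
  AntitoneOn.intervalIntegrable (ha.mono fun _ ht => (le_min h0 h1).trans ht.1)

lemma integral_le_of_antitoneOn_Ici (ha : AntitoneOn ν (Set.Ici 0)) {a b : ℝ}
    (h0 : 0 ≤ a) (hab : a ≤ b) : ∫ t in a..b, ν t ≤ (b - a) * ν a := by
  have h := intervalIntegral.integral_mono_on hab
    (intervalIntegrable_of_antitoneOn_Ici ha h0 (h0.trans hab)) intervalIntegrable_const
    (fun x hx => ha (Set.mem_Ici.2 h0) (Set.mem_Ici.2 (h0.trans hx.1)) hx.1)
  simpa using h

lemma le_integral_of_antitoneOn_Ici (ha : AntitoneOn ν (Set.Ici 0)) {a b : ℝ}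
    (h0 : 0 ≤ a) (hab : a ≤ b) : (b - a) * ν b ≤ ∫ t in a..b, ν t := by
  have h := intervalIntegral.integral_mono_on hab intervalIntegrable_const
    (intervalIntegrable_of_antitoneOn_Ici ha h0 (h0.trans hab))
    (fun x hx => ha (Set.mem_Ici.2 (h0.trans hx.1)) (Set.mem_Ici.2 (h0.trans hab)) hx.2)
  simpa using h

lemma Sfun_of_integrableOn (hi : IntegrableOn ν (Set.Ioi 0)) (x : ℝ) :
    Sfun ν x = ∫ t in Set.Ioi x, ν t := if_pos hi

lemma Sfun_of_not_integrableOn (hi : ¬ IntegrableOn ν (Set.Ioi 0)) {x : ℝ} (hx : 0 ≤ x) :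
    Sfun ν x = ∫ t in (0 : ℝ)..x, ν t := by
  rw [Sfun, if_neg hi, intervalIntegral.integral_of_le hx]

lemma Sfun_eq_integral_add (hi : IntegrableOn ν (Set.Ioi 0)) {x y : ℝ} (hx : 0 ≤ x)
    (hxy : x ≤ y) : Sfun ν x = (∫ t in x..y, ν t) + Sfun ν y := by
  rw [Sfun_of_integrableOn hi, Sfun_of_integrableOn hi,
    intervalIntegral.integral_interval_add_Ioi (hi.mono_set (Set.Ioi_subset_Ioi hx))
      (hi.mono_set (Set.Ioi_subset_Ioi (hx.trans hxy)))]

lemma Sfun_add_integral (hi : ¬ IntegrableOn ν (Set.Ioi 0)) (ha : AntitoneOn ν (Set.Ici 0))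
    {x y : ℝ} (hx : 0 ≤ x) (hy : 0 ≤ y) : Sfun ν y = Sfun ν x + ∫ t in x..y, ν t := by
  rw [Sfun_of_not_integrableOn hi hx, Sfun_of_not_integrableOn hi hy,
    intervalIntegral.integral_add_adjacent_intervals
      (intervalIntegrable_of_antitoneOn_Ici ha le_rfl hx)
      (intervalIntegrable_of_antitoneOn_Ici ha hx hy)]

lemma integral_pos_of_antitoneOn_Ici (hp : ∀ x, 0 ≤ x → 0 < ν x)
    (ha : AntitoneOn ν (Set.Ici 0)) {a b : ℝ} (h0 : 0 ≤ a) (hab : a < b) :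
    0 < ∫ t in a..b, ν t :=
  intervalIntegral.intervalIntegral_pos_of_pos_on
    (intervalIntegrable_of_antitoneOn_Ici ha h0 (h0.trans hab.le))
    (fun x hx => hp x (h0.trans hx.1.le)) hab

lemma Sfun_nonneg (hp : ∀ x, 0 ≤ x → 0 < ν x) {x : ℝ} (hx : 0 ≤ x) : 0 ≤ Sfun ν x := by
  by_cases hi : IntegrableOn ν (Set.Ioi 0)
  · rw [Sfun_of_integrableOn hi]
    exact setIntegral_nonneg measurableSet_Ioi fun t ht => (hp t (hx.trans (le_of_lt ht))).le
  · rw [Sfun_of_not_integrableOn hi hx]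
    exact intervalIntegral.integral_nonneg hx fun t ht => (hp t ht.1).le

lemma Sfun_pos (hp : ∀ x, 0 ≤ x → 0 < ν x) (ha : AntitoneOn ν (Set.Ici 0)) {x : ℝ}
    (hx : 0 < x) : 0 < Sfun ν x := by
  by_cases hi : IntegrableOn ν (Set.Ioi 0)
  · rw [Sfun_eq_integral_add hi hx.le (by linarith : x ≤ x + 1)]
    have h1 := integral_pos_of_antitoneOn_Ici hp ha hx.le (by linarith : x < x + 1)
    have h2 := Sfun_nonneg hp (by linarith : 0 ≤ x + 1)
    linarith
  · rw [Sfun_of_not_integrableOn hi hx.le]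
    exact integral_pos_of_antitoneOn_Ici hp ha le_rfl hx

lemma tendsto_Sfun_atTop (hp : ∀ x, 0 ≤ x → 0 < ν x) (ha : AntitoneOn ν (Set.Ici 0))
    (hi : ¬ IntegrableOn ν (Set.Ioi 0)) : Tendsto (Sfun ν) atTop atTop := by
  rw [tendsto_atTop]
  intro C
  have h : ∃ y, 0 ≤ y ∧ C ≤ Sfun ν y := by
    by_contra! h
    refine hi (integrableOn_Ioi_of_intervalIntegral_norm_bounded (b := fun x : ℝ => |x|)
      (l := atTop) C 0 (fun x => ?_) tendsto_abs_atTop_atTop ?_)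
    · exact (intervalIntegrable_iff_integrableOn_Ioc_of_le (abs_nonneg x)).1
        (intervalIntegrable_of_antitoneOn_Ici ha le_rfl (abs_nonneg x))
    · refine Eventually.of_forall fun x => ?_
      have h1 : ∫ t in (0 : ℝ)..|x|, ‖ν t‖ = ∫ t in (0 : ℝ)..|x|, ν t := by
        refine intervalIntegral.integral_congr fun t ht => ?_
        rw [Set.uIcc_of_le (abs_nonneg x)] at ht
        exact Real.norm_of_nonneg (hp t ht.1).le
      rw [h1, ← Sfun_of_not_integrableOn hi (abs_nonneg x)]
      exact (h _ (abs_nonneg x)).le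
  obtain ⟨y, hy, hC⟩ := h
  filter_upwards [eventually_ge_atTop y] with x hx
  have h1 := Sfun_add_integral hi ha hy (hy.trans hx)
  have h2 : 0 ≤ ∫ t in y..x, ν t :=
    intervalIntegral.integral_nonneg hx fun t ht => (hp t (hy.trans ht.1)).le
  linarith

lemma abs_Sfun_div_sub_one (hp : ∀ x, 0 ≤ x → 0 < ν x) (ha : AntitoneOn ν (Set.Ici 0))
    {x y : ℝ} (hx : 0 < x) (hxy : x ≤ y) :
    |Sfun ν y / Sfun ν x - 1| = (∫ t in x..y, ν t) / Sfun ν x := by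
  have hS := Sfun_pos hp ha hx
  have h2 : 0 ≤ ∫ t in x..y, ν t :=
    intervalIntegral.integral_nonneg hxy fun t ht => (hp t (hx.le.trans ht.1)).le
  rw [div_sub_one hS.ne', abs_div, abs_of_pos hS]
  congr 1
  by_cases hi : IntegrableOn ν (Set.Ioi 0)
  · have := Sfun_eq_integral_add hi hx.le hxy
    rw [abs_of_nonpos (by linarith)]
    linarith
  · have := Sfun_add_integral hi ha hx.le (hx.le.trans hxy)
    rw [abs_of_nonneg (by linarith)]
    linarith

lemma integral_mul_le_integral_mul (hp : ∀ x, 0 ≤ x → 0 < ν x)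
    (ha : AntitoneOn ν (Set.Ici 0)) {x l m : ℝ} (hx : 0 < x) (hl : 1 < l) (hm : 1 < m) :
    ∫ t in x..m * x, ν t ≤ (1 + |m - l| / (l - 1)) * ∫ t in x..l * x, ν t := by
  have hxl : x < l * x := by nlinarith
  have hxm : x < m * x := by nlinarith
  have hG := integral_pos_of_antitoneOn_Ici hp ha hx.le hxl
  have hl1 : 0 < l - 1 := by linarith
  have hsum := intervalIntegral.integral_add_adjacent_intervals
    (intervalIntegrable_of_antitoneOn_Ici ha hx.le (hx.le.trans hxl.le))
    (intervalIntegrable_of_antitoneOn_Ici ha (hx.le.trans hxl.le) (hx.le.trans hxm.le))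
  rcases le_total m l with h | h
  · have h1 : 0 ≤ ∫ t in m * x..l * x, ν t :=
      intervalIntegral.integral_nonneg (by nlinarith) fun t ht =>
        (hp t ((hx.le.trans hxm.le).trans ht.1)).le
    rw [intervalIntegral.integral_symm] at h1
    have h2 : 0 ≤ |m - l| / (l - 1) * ∫ t in x..l * x, ν t := by positivity
    linarith
  · have h1 := integral_le_of_antitoneOn_Ici ha (hx.le.trans hxl.le)
      (by nlinarith : l * x ≤ m * x)
    have h2 := le_integral_of_antitoneOn_Ici ha hx.le hxl.le
    rw [abs_of_nonneg (by linarith)]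
    have h3 : (m * x - l * x) * ν (l * x) = (m - l) / (l - 1) * ((l * x - x) * ν (l * x)) := by
      field_simp
    have h4 : (m - l) / (l - 1) * ((l * x - x) * ν (l * x)) ≤
        (m - l) / (l - 1) * ∫ t in x..l * x, ν t :=
      mul_le_mul_of_nonneg_left h2 (div_nonneg (by linarith) hl1.le)
    linarith

lemma not_eccentric_of_eventually_le (hp : ∀ x, 0 ≤ x → 0 < ν x)
    (ha : AntitoneOn ν (Set.Ici 0)) {m ε : ℝ} (hm : 1 < m) (hε : 0 < ε)
    (h : ∀ᶠ x in atTop, ε * Sfun ν x ≤ ∫ t in x..m * x, ν t) : ¬ Eccentric ν := by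
  rintro ⟨l, hl, hc⟩
  have hl1 : 0 < l - 1 := by linarith
  have hC : 0 < 1 + |m - l| / (l - 1) := by positivity
  rw [Metric.nhds_basis_ball.mapClusterPt_iff_frequently] at hc
  obtain ⟨x, hx, hm', hx0⟩ :=
    ((hc (ε / (1 + |m - l| / (l - 1))) (div_pos hε hC)).and_eventually
      (h.and (eventually_gt_atTop 0))).exists
  rw [Metric.mem_ball, Real.dist_eq, abs_Sfun_div_sub_one hp ha hx0 (by nlinarith),
    div_lt_div_iff₀ (Sfun_pos hp ha hx0) hC] at hx
  have := integral_mul_le_integral_mul hp ha hx0 hl hm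
  linarith

lemma eventually_le_of_not_eccentric (hp : ∀ x, 0 ≤ x → 0 < ν x)
    (ha : AntitoneOn ν (Set.Ici 0)) (h : ¬ Eccentric ν) {m : ℝ} (hm : 1 < m) :
    ∃ ε > 0, ∀ᶠ x in atTop, ε * Sfun ν x ≤ ∫ t in x..m * x, ν t := by
  have h1 : ¬ MapClusterPt (1 : ℝ) atTop (fun x => Sfun ν (m * x) / Sfun ν x) :=
    fun hc => h ⟨m, hm, hc⟩
  rw [Metric.nhds_basis_ball.mapClusterPt_iff_frequently] at h1
  push Not at h1
  obtain ⟨ε, hε, h2⟩ := h1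
  refine ⟨ε, hε, ?_⟩
  filter_upwards [h2, eventually_gt_atTop 0] with x hx hx0
  rw [Metric.mem_ball, Real.dist_eq, abs_Sfun_div_sub_one hp ha hx0 (by nlinarith), not_lt,
    le_div_iff₀ (Sfun_pos hp ha hx0)] at hx
  exact hx

lemma not_integrableOn_of_le_mul (hp : ∀ x, 0 ≤ x → 0 < ν x)
    (ha : AntitoneOn ν (Set.Ici 0)) {l a : ℝ} (hl : 1 < l) (hal : a < l)
    (h : ∀ᶠ x in atTop, ν x ≤ a * ν (l * x)) : ¬ IntegrableOn ν (Set.Ioi 0) := by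
  intro hi
  obtain ⟨x, hx⟩ := eventually_atTop.1 (h.and (eventually_gt_atTop 0))
  have hx0 : 0 < x := (hx x le_rfl).2
  have hl0 : 0 < l := by linarith
  have hxl : x < l * x := by nlinarith
  have ha0 : 0 < a := by
    have h1 := (hx x le_rfl).1
    have h2 := hp x hx0.le
    have h3 := hp (l * x) (by positivity)
    by_contra! h4
    nlinarith
  have hint : IntegrableOn (fun t => ν (l * t)) (Set.Ioi x) := by
    rw [integrableOn_Ioi_comp_mul_left_iff _ _ hl0]
    exact hi.mono_set (Set.Ioi_subset_Ioi (by positivity))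
  have h1 : ∫ t in Set.Ioi x, ν t ≤ ∫ t in Set.Ioi x, a * ν (l * t) :=
    setIntegral_mono_on (hi.mono_set (Set.Ioi_subset_Ioi hx0.le)) (hint.const_mul a)
      measurableSet_Ioi fun t ht => (hx t (le_of_lt ht)).1
  rw [integral_const_mul, integral_comp_mul_left_Ioi _ _ hl0, smul_eq_mul,
    ← Sfun_of_integrableOn hi, ← Sfun_of_integrableOn hi] at h1
  have h2 := Sfun_eq_integral_add hi hx0.le hxl.le
  have h3 := integral_pos_of_antitoneOn_Ici hp ha hx0.le hxl
  have h4 := Sfun_pos hp ha (by positivity : 0 < l * x)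
  have h5 : a * (l⁻¹ * Sfun ν (l * x)) ≤ 1 * Sfun ν (l * x) := by
    rw [← mul_assoc]
    refine mul_le_mul_of_nonneg_right ?_ h4.le
    rw [← div_eq_mul_inv, div_le_one hl0]
    exact hal.le
  linarith

lemma not_eccentric_of_le_mul (hp : ∀ x, 0 ≤ x → 0 < ν x)
    (ha : AntitoneOn ν (Set.Ici 0)) {l a : ℝ} (hl : 1 < l) (hal : a < l)
    (h : ∀ᶠ x in atTop, ν x ≤ a * ν (l * x)) : ¬ Eccentric ν := by
  have hi := not_integrableOn_of_le_mul hp ha hl hal h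
  obtain ⟨x₀, hx⟩ := eventually_atTop.1 (h.and (eventually_gt_atTop 0))
  have hx0 : 0 < x₀ := (hx x₀ le_rfl).2
  have hl0 : 0 < l := by linarith
  have ha0 : 0 < a := by
    have h1 := (hx x₀ le_rfl).1
    have h2 := hp x₀ hx0.le
    have h3 := hp (l * x₀) (by positivity)
    by_contra! h4
    nlinarith
  have hq : 0 < l / a - 1 := by
    rw [sub_pos, lt_div_iff₀ ha0]
    linarith
  refine not_eccentric_of_eventually_le hp ha hl (half_pos hq) ?_
  filter_upwards [eventually_ge_atTop x₀, (tendsto_Sfun_atTop hp ha hi).eventually_ge_atTop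
    (2 * (l / a) * Sfun ν x₀ / (l / a - 1))] with x hxx hS
  have hxp : 0 < x := hx0.trans_le hxx
  rw [div_le_iff₀ hq] at hS
  have hlx : l * x₀ ≤ l * x := by gcongr
  have hcomp : IntervalIntegrable (fun t => ν (l * t)) volume x₀ x := by
    refine AntitoneOn.intervalIntegrable fun s hs t ht hst => ?_
    rw [Set.uIcc_of_le hxx] at hs ht
    exact ha (Set.mem_Ici.2 (mul_nonneg hl0.le (hx0.le.trans hs.1)))
      (Set.mem_Ici.2 (mul_nonneg hl0.le (hx0.le.trans ht.1))) (by gcongr)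
  have h1 : ∫ t in x₀..x, ν t ≤ ∫ t in x₀..x, a * ν (l * t) :=
    intervalIntegral.integral_mono_on hxx
      (intervalIntegrable_of_antitoneOn_Ici ha hx0.le hxp.le) (hcomp.const_mul a)
      fun t ht => (hx t ht.1).1
  rw [intervalIntegral.integral_const_mul, intervalIntegral.integral_comp_mul_left _ hl0.ne',
    smul_eq_mul] at h1
  have h2 := Sfun_add_integral hi ha hx0.le hxp.le
  have h3 := Sfun_add_integral hi ha (by positivity : 0 ≤ l * x₀) (by positivity : 0 ≤ l * x)
  have h4 := Sfun_add_integral hi ha hxp.le (by positivity : 0 ≤ l * x)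
  have h5 := Sfun_nonneg hp (by positivity : 0 ≤ l * x₀)
  have h6 : l / a * ∫ t in x₀..x, ν t ≤ ∫ t in l * x₀..l * x, ν t := by
    calc l / a * ∫ t in x₀..x, ν t ≤ l / a * (a * (l⁻¹ * ∫ t in l * x₀..l * x, ν t)) := by
          gcongr
      _ = _ := by field_simp
  have h7 : ∫ t in x₀..x, ν t = Sfun ν x - Sfun ν x₀ := by linarith
  rw [h7] at h6
  nlinarith

lemma integrableOn_of_mul_le (hp : ∀ x, 0 ≤ x → 0 < ν x)
    (ha : AntitoneOn ν (Set.Ici 0)) {l a : ℝ} (hl : 1 < l) (hal : l < a)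
    (h : ∀ᶠ x in atTop, a * ν (l * x) ≤ ν x) : IntegrableOn ν (Set.Ioi 0) := by
  by_contra hi
  obtain ⟨x₀, hx⟩ := eventually_atTop.1 (h.and (eventually_gt_atTop 0))
  have hx0 : 0 < x₀ := (hx x₀ le_rfl).2
  have hl0 : 0 < l := by linarith
  have ha0 : 0 < a := by linarith
  have hq : 0 < 1 - l / a := by
    rw [sub_pos, div_lt_one ha0]
    exact hal
  obtain ⟨x, hxx, hS⟩ := ((eventually_ge_atTop x₀).and
    ((tendsto_Sfun_atTop hp ha hi).eventually_gt_atTop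
      (Sfun ν (l * x₀) / (1 - l / a)))).exists
  have hxp : 0 < x := hx0.trans_le hxx
  rw [div_lt_iff₀ hq] at hS
  have hcomp : IntervalIntegrable (fun t => ν (l * t)) volume x₀ x := by
    refine AntitoneOn.intervalIntegrable fun s hs t ht hst => ?_
    rw [Set.uIcc_of_le hxx] at hs ht
    exact ha (Set.mem_Ici.2 (mul_nonneg hl0.le (hx0.le.trans hs.1)))
      (Set.mem_Ici.2 (mul_nonneg hl0.le (hx0.le.trans ht.1))) (by gcongr)
  have h1 : ∫ t in x₀..x, a * ν (l * t) ≤ ∫ t in x₀..x, ν t :=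
    intervalIntegral.integral_mono_on hxx (hcomp.const_mul a)
      (intervalIntegrable_of_antitoneOn_Ici ha hx0.le hxp.le)
      fun t ht => (hx t ht.1).1
  rw [intervalIntegral.integral_const_mul, intervalIntegral.integral_comp_mul_left _ hl0.ne',
    smul_eq_mul] at h1
  have h2 := Sfun_add_integral hi ha hx0.le hxp.le
  have h3 := Sfun_add_integral hi ha (by positivity : 0 ≤ l * x₀) (by positivity : 0 ≤ l * x)
  have h4 := Sfun_add_integral hi ha hxp.le (by positivity : 0 ≤ l * x)
  have h5 := Sfun_nonneg hp hx0.le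
  have h8 := integral_pos_of_antitoneOn_Ici hp ha hxp.le (by nlinarith : x < l * x)
  have h6 : ∫ t in l * x₀..l * x, ν t ≤ l / a * ∫ t in x₀..x, ν t := by
    calc ∫ t in l * x₀..l * x, ν t = l / a * (a * (l⁻¹ * ∫ t in l * x₀..l * x, ν t)) := by
          field_simp
      _ ≤ _ := by gcongr
  have h7 : ∫ t in x₀..x, ν t = Sfun ν x - Sfun ν x₀ := by linarith
  have h9 : 0 ≤ l / a * Sfun ν x₀ := by positivity
  rw [h7] at h6
  nlinarith

lemma not_eccentric_of_mul_le (hp : ∀ x, 0 ≤ x → 0 < ν x)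
    (ha : AntitoneOn ν (Set.Ici 0)) {l a : ℝ} (hl : 1 < l) (hal : l < a)
    (h : ∀ᶠ x in atTop, a * ν (l * x) ≤ ν x) : ¬ Eccentric ν := by
  have hi := integrableOn_of_mul_le hp ha hl hal h
  obtain ⟨x₀, hx⟩ := eventually_atTop.1 (h.and (eventually_gt_atTop 0))
  have hl0 : 0 < l := by linarith
  have ha0 : 0 < a := by linarith
  have hq : 0 < 1 - l / a := by
    rw [sub_pos, div_lt_one ha0]
    exact hal
  refine not_eccentric_of_eventually_le hp ha hl hq ?_
  filter_upwards [eventually_ge_atTop x₀] with x hxx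
  have hxp : 0 < x := (hx x hxx).2
  have hint : IntegrableOn (fun t => ν (l * t)) (Set.Ioi x) := by
    rw [integrableOn_Ioi_comp_mul_left_iff _ _ hl0]
    exact hi.mono_set (Set.Ioi_subset_Ioi (by positivity))
  have h1 : ∫ t in Set.Ioi x, a * ν (l * t) ≤ ∫ t in Set.Ioi x, ν t :=
    setIntegral_mono_on (hint.const_mul a) (hi.mono_set (Set.Ioi_subset_Ioi hxp.le))
      measurableSet_Ioi fun t ht => (hx t (hxx.trans (le_of_lt ht))).1
  rw [integral_const_mul, integral_comp_mul_left_Ioi _ _ hl0, smul_eq_mul,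
    ← Sfun_of_integrableOn hi, ← Sfun_of_integrableOn hi] at h1
  have h2 := Sfun_eq_integral_add hi hxp.le (by nlinarith : x ≤ l * x)
  have h6 : Sfun ν (l * x) ≤ l / a * Sfun ν x := by
    calc Sfun ν (l * x) = l / a * (a * (l⁻¹ * Sfun ν (l * x))) := by field_simp
      _ ≤ _ := by gcongr
  linarith

lemma exists_le_pow_mul_of_not_eccentric (hp : ∀ x, 0 ≤ x → 0 < ν x)
    (ha : AntitoneOn ν (Set.Ici 0)) (hi : ¬ IntegrableOn ν (Set.Ioi 0))
    (h : ¬ Eccentric ν) :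
    ∃ C a : ℝ, 0 < C ∧ 0 < a ∧ a < 2 ∧
      ∀ k : ℕ, ∀ᶠ x in atTop, ν x ≤ C * a ^ k * ν (2 ^ k * x) := by
  obtain ⟨ε, hε, h1⟩ := eventually_le_of_not_eccentric hp ha h one_lt_two
  obtain ⟨x₀, hx⟩ := eventually_atTop.1 (h1.and (eventually_gt_atTop 0))
  refine ⟨ε⁻¹, 2 / (1 + ε), by positivity, by positivity, ?_, fun k => ?_⟩
  · rw [div_lt_iff₀ (by linarith)]
    linarith
  filter_upwards [eventually_ge_atTop x₀] with x hxx
  have hxp : 0 < x := (hx x hxx).2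
  have hge : ∀ k : ℕ, x ≤ 2 ^ k * x := fun k =>
    le_mul_of_one_le_left hxp.le (one_le_pow₀ one_le_two)
  have hpow : ∀ k : ℕ, (1 + ε) ^ k * Sfun ν x ≤ Sfun ν (2 ^ k * x) := by
    intro k
    induction k with
    | zero => simp
    | succ k ih =>
      have h2 := (hx (2 ^ k * x) (hxx.trans (hge k))).1
      have h3 := Sfun_add_integral hi ha (by positivity : 0 ≤ 2 ^ k * x)
        (by positivity : 0 ≤ 2 * (2 ^ k * x))
      rw [pow_succ', pow_succ', mul_assoc, mul_assoc, h3]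
      have h4 : (1 + ε) * ((1 + ε) ^ k * Sfun ν x) ≤ (1 + ε) * Sfun ν (2 ^ k * x) := by
        gcongr
      linarith
  have h2 : x * ν x ≤ Sfun ν x := by
    rw [Sfun_of_not_integrableOn hi hxp.le]
    simpa using le_integral_of_antitoneOn_Ici ha le_rfl hxp.le
  have h3 := (hx (2 ^ k * x) (hxx.trans (hge k))).1
  have h4 := integral_le_of_antitoneOn_Ici ha (by positivity : 0 ≤ 2 ^ k * x)
    (by linarith [hge k] : 2 ^ k * x ≤ 2 * (2 ^ k * x))
  have h5 : ε * ((1 + ε) ^ k * (x * ν x)) ≤ 2 ^ k * x * ν (2 ^ k * x) := by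
    calc ε * ((1 + ε) ^ k * (x * ν x)) ≤ ε * ((1 + ε) ^ k * Sfun ν x) := by gcongr
      _ ≤ ε * Sfun ν (2 ^ k * x) := by gcongr; exact hpow k
      _ ≤ _ := by linarith
  have h6 : ε * (1 + ε) ^ k * ν x ≤ 2 ^ k * ν (2 ^ k * x) := by
    refine le_of_mul_le_mul_left ?_ hxp
    linarith
  rw [div_pow]
  have h7 : ε⁻¹ * (2 ^ k / (1 + ε) ^ k) * ν (2 ^ k * x) =
      2 ^ k * ν (2 ^ k * x) / (ε * (1 + ε) ^ k) := by field_simp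
  rw [h7, le_div_iff₀ (by positivity)]
  linarith

lemma exists_pow_mul_le_of_not_eccentric (hp : ∀ x, 0 ≤ x → 0 < ν x)
    (ha : AntitoneOn ν (Set.Ici 0)) (hi : IntegrableOn ν (Set.Ioi 0))
    (h : ¬ Eccentric ν) :
    ∃ C a : ℝ, 0 < C ∧ 2 < a ∧
      ∀ k : ℕ, ∀ᶠ x in atTop, a ^ k * ν (2 ^ k * x) ≤ C * ν x := by
  obtain ⟨ε, hε, h1⟩ := eventually_le_of_not_eccentric hp ha h one_lt_two
  obtain ⟨x₀, hx⟩ := eventually_atTop.1 (h1.and (eventually_gt_atTop 0))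
  have hstep : ∀ x, x₀ ≤ x → Sfun ν (2 * x) ≤ (1 - ε) * Sfun ν x := fun x hxx => by
    have h2 := Sfun_eq_integral_add hi (hx x hxx).2.le
      (by linarith [(hx x hxx).2] : x ≤ 2 * x)
    linarith [(hx x hxx).1]
  have hε1 : 0 < 1 - ε := by
    have h2 := hstep x₀ le_rfl
    have h3 := Sfun_pos hp ha (hx x₀ le_rfl).2
    have h4 := Sfun_pos hp ha (by linarith [(hx x₀ le_rfl).2] : 0 < 2 * x₀)
    by_contra! h5
    nlinarith
  have ha2 : 2 < 2 / (1 - ε) := by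
    rw [lt_div_iff₀ hε1]
    linarith
  refine ⟨2 / (1 - ε) / ε, 2 / (1 - ε), by positivity, ha2, fun k => ?_⟩
  filter_upwards [eventually_ge_atTop x₀] with x hxx
  have hxp : 0 < x := (hx x hxx).2
  rcases k with _ | k
  · have h2 : 1 ≤ 2 / (1 - ε) / ε := by
      rw [le_div_iff₀ hε]
      linarith
    simpa using le_mul_of_one_le_left (hp x hxp.le).le h2
  have hge : ∀ k : ℕ, x ≤ 2 ^ k * x := fun k =>
    le_mul_of_one_le_left hxp.le (one_le_pow₀ one_le_two)
  have hpow : ∀ k : ℕ, Sfun ν (2 ^ k * x) ≤ (1 - ε) ^ k * Sfun ν x := by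
    intro k
    induction k with
    | zero => simp
    | succ k ih =>
      rw [pow_succ', pow_succ', mul_assoc, mul_assoc]
      exact (hstep _ (hxx.trans (hge k))).trans (by gcongr)
  have h2 : ε * Sfun ν x ≤ x * ν x := by
    have h3 := integral_le_of_antitoneOn_Ici ha hxp.le (by linarith : x ≤ 2 * x)
    linarith [(hx x hxx).1]
  have h3 := le_integral_of_antitoneOn_Ici ha (by positivity : 0 ≤ 2 ^ k * x)
    (by linarith [hge k] : 2 ^ k * x ≤ 2 * (2 ^ k * x))
  have h4 := Sfun_eq_integral_add hi (by positivity : 0 ≤ 2 ^ k * x)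
    (by linarith [hge k] : 2 ^ k * x ≤ 2 * (2 ^ k * x))
  have h5 := Sfun_nonneg hp (by positivity : 0 ≤ 2 * (2 ^ k * x))
  have h6 : ε * (2 ^ k * x * ν (2 * (2 ^ k * x))) ≤ (1 - ε) ^ k * (x * ν x) := by
    calc ε * (2 ^ k * x * ν (2 * (2 ^ k * x))) ≤ ε * ((1 - ε) ^ k * Sfun ν x) := by
          refine mul_le_mul_of_nonneg_left ?_ hε.le
          linarith [hpow k]
      _ = (1 - ε) ^ k * (ε * Sfun ν x) := by ring
      _ ≤ _ := by gcongr
  have h7 : ε * 2 ^ k * ν (2 * (2 ^ k * x)) ≤ (1 - ε) ^ k * ν x := by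
    refine le_of_mul_le_mul_left ?_ hxp
    linarith
  rw [pow_succ' (2 : ℝ), mul_assoc, pow_succ', div_pow]
  calc 2 / (1 - ε) * (2 ^ k / (1 - ε) ^ k) * ν (2 * (2 ^ k * x))
      = 2 / (1 - ε) / ε / (1 - ε) ^ k * (ε * 2 ^ k * ν (2 * (2 ^ k * x))) := by field_simp
    _ ≤ 2 / (1 - ε) / ε / (1 - ε) ^ k * ((1 - ε) ^ k * ν x) := by gcongr
    _ = _ := by field_simp

end AntitoneIntegrals

section Indices

variable {μ : ℝ → ℝ} {γ : ℝ}

lemma log_rpow_div (hpos : ∀ x, 0 ≤ x → 0 < μ x) {x y : ℝ} (hx : 0 ≤ x) (hy : 0 ≤ y) :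
    Real.log (μ x ^ γ / μ y ^ γ) = γ * Real.log (μ x / μ y) := by
  rw [← Real.div_rpow (hpos x hx).le (hpos y hy).le,
    Real.log_rpow (div_pos (hpos x hx) (hpos y hy))]

lemma exists_le_mul_of_ratioSup_lt (hpos : ∀ x, 0 ≤ x → 0 < μ x) (hγ : 0 < γ) {D : ENNReal}
    (hD : Tendsto (ratioSup μ) atTop (nhds D)) (h : D < ENNReal.ofReal γ⁻¹) :
    ∃ l a : ℝ, 1 < l ∧ a < l ∧ ∀ᶠ x in atTop, μ x ^ γ ≤ a * μ (l * x) ^ γ := by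
  obtain ⟨q, hq0, hDq, hq⟩ := ENNReal.lt_iff_exists_real_btwn.1 h
  have hqγ : γ * q < 1 := by
    have h1 := (ENNReal.ofReal_lt_ofReal_iff (inv_pos.2 hγ)).1 hq
    calc γ * q < γ * γ⁻¹ := by gcongr
      _ = 1 := mul_inv_cancel₀ hγ.ne'
  obtain ⟨l, hlq, hl⟩ := ((hD.eventually_lt_const hDq).and (eventually_gt_atTop 1)).exists
  have hl0 : 0 < l := by linarith
  have hlog : 0 < Real.log l := Real.log_pos hl
  refine ⟨l, l ^ (γ * q), hl, ?_, ?_⟩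
  · simpa using Real.rpow_lt_rpow_of_exponent_lt hl hqγ
  filter_upwards [eventually_lt_of_limsup_lt hlq, eventually_ge_atTop 0] with x hx hx0
  have hlx : 0 ≤ l * x := by positivity
  have h1 := Real.rpow_pos_of_pos (hpos x hx0) γ
  have h2 := Real.rpow_pos_of_pos (hpos _ hlx) γ
  have h3 : Real.log (μ x / μ (l * x)) / Real.log l < q := (ENNReal.ofReal_lt_ofReal_iff'.1 hx).1
  rw [div_lt_iff₀ hlog] at h3
  rw [← div_le_iff₀ h2, ← Real.log_le_log_iff (div_pos h1 h2) (Real.rpow_pos_of_pos hl0 _),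
    log_rpow_div hpos hx0 hlx, Real.log_rpow hl0, mul_assoc]
  gcongr

lemma exists_mul_le_of_lt_ratioInf (hpos : ∀ x, 0 ≤ x → 0 < μ x) (hγ : 0 < γ) {D : ENNReal}
    (hD : Tendsto (ratioInf μ) atTop (nhds D)) (h : ENNReal.ofReal γ⁻¹ < D) :
    ∃ l a : ℝ, 1 < l ∧ l < a ∧ ∀ᶠ x in atTop, a * μ (l * x) ^ γ ≤ μ x ^ γ := by
  obtain ⟨q, hq0, hq, hDq⟩ := ENNReal.lt_iff_exists_real_btwn.1 h
  have hqγ : 1 < γ * q := by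
    have h1 := (ENNReal.ofReal_lt_ofReal_iff'.1 hq).1
    calc 1 = γ * γ⁻¹ := (mul_inv_cancel₀ hγ.ne').symm
      _ < γ * q := by gcongr
  obtain ⟨l, hlq, hl⟩ := ((hD.eventually_const_lt hDq).and (eventually_gt_atTop 1)).exists
  have hl0 : 0 < l := by linarith
  have hlog : 0 < Real.log l := Real.log_pos hl
  refine ⟨l, l ^ (γ * q), hl, ?_, ?_⟩
  · simpa using Real.rpow_lt_rpow_of_exponent_lt hl hqγ
  filter_upwards [eventually_lt_of_lt_liminf hlq, eventually_ge_atTop 0] with x hx hx0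
  have hlx : 0 ≤ l * x := by positivity
  have h1 := Real.rpow_pos_of_pos (hpos x hx0) γ
  have h2 := Real.rpow_pos_of_pos (hpos _ hlx) γ
  have h3 : q < Real.log (μ x / μ (l * x)) / Real.log l := (ENNReal.ofReal_lt_ofReal_iff'.1 hx).1
  rw [lt_div_iff₀ hlog] at h3
  rw [← le_div_iff₀ h2, ← Real.log_le_log_iff (Real.rpow_pos_of_pos hl0 _) (div_pos h1 h2),
    log_rpow_div hpos hx0 hlx, Real.log_rpow hl0, mul_assoc]
  gcongr

lemma tendsto_log_mul_pow_div (C a : ℝ) (hC : 0 < C) (ha : 0 < a) :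
    Tendsto (fun k : ℕ => ENNReal.ofReal (Real.log (C * a ^ k) / γ / Real.log (2 ^ k))) atTop
      (nhds (ENNReal.ofReal (Real.log a / γ / Real.log 2))) := by
  refine ENNReal.tendsto_ofReal ?_
  have h1 : Tendsto (fun k : ℕ => Real.log C / γ / Real.log 2 / (k : ℝ)
      + Real.log a / γ / Real.log 2) atTop (nhds (0 + Real.log a / γ / Real.log 2)) :=
    (tendsto_const_div_atTop_nhds_zero_nat _).add_const _
  rw [zero_add] at h1
  refine h1.congr' ?_
  filter_upwards [eventually_gt_atTop 0] with k hk
  have hk' : (k : ℝ) ≠ 0 := by positivity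
  have h2 : Real.log 2 ≠ 0 := (Real.log_pos one_lt_two).ne'
  rw [Real.log_mul hC.ne' (by positivity), Real.log_pow, Real.log_pow]
  field_simp

lemma ratioSup_lt_of_le_pow_mul (hpos : ∀ x, 0 ≤ x → 0 < μ x) (hγ : 0 < γ) {D : ENNReal}
    (hD : Tendsto (ratioSup μ) atTop (nhds D)) {C a : ℝ} (hC : 0 < C) (ha : 0 < a)
    (ha2 : a < 2) (h : ∀ k : ℕ, ∀ᶠ x in atTop, μ x ^ γ ≤ C * a ^ k * μ (2 ^ k * x) ^ γ) :
    D < ENNReal.ofReal γ⁻¹ := by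
  have hD' := hD.comp (tendsto_pow_atTop_atTop_of_one_lt (one_lt_two (α := ℝ)))
  have hlog2 : 0 < Real.log 2 := Real.log_pos one_lt_two
  refine (le_of_tendsto_of_tendsto hD' (tendsto_log_mul_pow_div (γ := γ) C a hC ha) ?_).trans_lt ?_
  · filter_upwards [eventually_gt_atTop 0] with k hk
    refine limsup_le_of_le (by isBoundedDefault) ?_
    filter_upwards [h k, eventually_ge_atTop 0] with x hx hx0
    have hlx : 0 ≤ 2 ^ k * x := by positivity
    have h1 := Real.rpow_pos_of_pos (hpos x hx0) γ
    have h2 := Real.rpow_pos_of_pos (hpos _ hlx) γ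
    have h3 : 0 ≤ Real.log ((2 : ℝ) ^ k) := Real.log_nonneg (one_le_pow₀ one_le_two)
    rw [← div_le_iff₀ h2, ← Real.log_le_log_iff (div_pos h1 h2) (by positivity),
      log_rpow_div hpos hx0 hlx, ← le_div_iff₀' hγ] at hx
    gcongr
  · rw [ENNReal.ofReal_lt_ofReal_iff (inv_pos.2 hγ), div_lt_iff₀ hlog2, div_eq_inv_mul]
    gcongr

lemma lt_ratioInf_of_pow_mul_le (hpos : ∀ x, 0 ≤ x → 0 < μ x) (hγ : 0 < γ) {D : ENNReal}
    (hD : Tendsto (ratioInf μ) atTop (nhds D)) {C a : ℝ} (hC : 0 < C)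
    (ha2 : 2 < a) (h : ∀ k : ℕ, ∀ᶠ x in atTop, a ^ k * μ (2 ^ k * x) ^ γ ≤ C * μ x ^ γ) :
    ENNReal.ofReal γ⁻¹ < D := by
  have hD' := hD.comp (tendsto_pow_atTop_atTop_of_one_lt (one_lt_two (α := ℝ)))
  have hlog2 : 0 < Real.log 2 := Real.log_pos one_lt_two
  have ha : 0 < a := by linarith
  refine lt_of_lt_of_le ?_ (le_of_tendsto_of_tendsto
    (tendsto_log_mul_pow_div (γ := γ) C⁻¹ a (inv_pos.2 hC) ha) hD' ?_)
  · have h1 : γ⁻¹ < Real.log a / γ / Real.log 2 := by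
      rw [lt_div_iff₀ hlog2, div_eq_inv_mul]
      gcongr
    exact ENNReal.ofReal_lt_ofReal_iff'.2 ⟨h1, (inv_pos.2 hγ).trans h1⟩
  · filter_upwards [eventually_gt_atTop 0] with k hk
    refine le_liminf_of_le (by isBoundedDefault) ?_
    filter_upwards [h k, eventually_ge_atTop 0] with x hx hx0
    have hlx : 0 ≤ 2 ^ k * x := by positivity
    have h1 := Real.rpow_pos_of_pos (hpos x hx0) γ
    have h2 := Real.rpow_pos_of_pos (hpos _ hlx) γ
    have h3 : 0 ≤ Real.log ((2 : ℝ) ^ k) := Real.log_nonneg (one_le_pow₀ one_le_two)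
    rw [← inv_mul_le_iff₀ hC, ← mul_assoc, ← le_div_iff₀ h2,
      ← Real.log_le_log_iff (by positivity) (div_pos h1 h2),
      log_rpow_div hpos hx0 hlx, ← div_le_iff₀' hγ] at hx
    gcongr

end Indices

/-- Theorem 1.9 (`Thm:eccint`): for a strictly positive `μ ∈ M`, the set of eccentricity
exponents `{γ > 0 : μ^γ eccentric}` is exactly `[δ̲(μ), δ̄(μ)] ∩ (0,∞)`; in particular it
is a relatively closed subinterval of `(0,∞)` with endpoints `δ̲(μ)` and `δ̄(μ)`. -/
theorem stmt7 (μ : ℝ → ℝ)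
    (hpos : ∀ x : ℝ, 0 ≤ x → 0 < μ x)
    (hanti : AntitoneOn μ (Set.Ici 0))
    (hrc : ∀ x : ℝ, 0 ≤ x → ContinuousWithinAt μ (Set.Ici x) x)
    (hlim : Tendsto μ atTop (nhds 0))
    (dlow dup : ENNReal) (hdlow : IsDeltaLow μ dlow) (hdup : IsDeltaUp μ dup) :
    {γ : ℝ | 0 < γ ∧ Eccentric (fun x => μ x ^ γ)} =
      {γ : ℝ | 0 < γ ∧ dlow ≤ ENNReal.ofReal γ ∧ ENNReal.ofReal γ ≤ dup} := by
  obtain ⟨Ds, rfl, hDs⟩ := hdlow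
  obtain ⟨Di, rfl, hDi⟩ := hdup
  ext γ
  simp only [Set.mem_ofPred_eq]
  refine and_congr_right fun hγ => ?_
  rw [ENNReal.inv_le_iff_inv_le, ENNReal.le_inv_iff_le_inv, ← ENNReal.ofReal_inv_of_pos hγ]
  have hp : ∀ x : ℝ, 0 ≤ x → 0 < μ x ^ γ := fun x hx => Real.rpow_pos_of_pos (hpos x hx) γ
  have ha : AntitoneOn (fun x => μ x ^ γ) (Set.Ici 0) := fun x hx y hy hxy =>
    Real.rpow_le_rpow (hpos y hy).le (hanti hx hy hxy) hγ.le
  constructor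
  · intro he
    constructor
    · by_contra! hlt
      obtain ⟨l, a, hl, hal, h⟩ := exists_le_mul_of_ratioSup_lt hpos hγ hDs hlt
      exact not_eccentric_of_le_mul hp ha hl hal h he
    · by_contra! hlt
      obtain ⟨l, a, hl, hal, h⟩ := exists_mul_le_of_lt_ratioInf hpos hγ hDi hlt
      exact not_eccentric_of_mul_le hp ha hl hal h he
  · rintro ⟨hs, hi⟩
    by_contra he
    by_cases hint : IntegrableOn (fun x => μ x ^ γ) (Set.Ioi 0)
    · obtain ⟨C, a, hC, ha2, h⟩ := exists_pow_mul_le_of_not_eccentric hp ha hint he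
      exact (lt_ratioInf_of_pow_mul_le hpos hγ hDi hC ha2 h).not_ge hi
    · obtain ⟨C, a, hC, ha0, ha2, h⟩ := exists_le_pow_mul_of_not_eccentric hp ha hint he
      exact (ratioSup_lt_of_le_pow_mul hpos hγ hDs hC ha0 ha2 h).not_ge hs
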